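/- For every p ∈ ℝ, the Wigner-like transform Wig_p maps S(ℝ²) into S(ℝ²) and is a linear topological isomorphism of S(ℝ²) onto itself, i.e., it is bijective, continuous, and has continuous inverse. -/

import Mathlib

open MeasureTheory SchwartzMap Complex Filter

noncomputable section




-- function-level operators on ℝ → ℂ and ℝ × ℝ → ℂ

/-- `D = -i d/dx` acting on functions `ℝ → ℂ`. -/
def cD (u : ℝ → ℂ) : ℝ → ℂ := fun x => -Complex.I * deriv u x

/-- `D₁ = -i ∂ₓ` acting on functions `ℝ × ℝ → ℂ`. -/
def cD1 (f : ℝ × ℝ → ℂ) : ℝ × ℝ → ℂ := fun v => -Complex.I * fderiv ℝ f v (1, 0)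

/-- `D₂ = -i ∂_y` acting on functions `ℝ × ℝ → ℂ`. -/
def cD2 (f : ℝ × ℝ → ℂ) : ℝ × ℝ → ℂ := fun v => -Complex.I * fderiv ℝ f v (0, 1)

/-- The Wigner-like transform with parameter `p`:
`Wig_p[f](x,y) = (2π)^{-1/2} ∫ e^{-izy} f(x+(1-p)z, x-pz) dz`. -/
def Wig (p : ℝ) (f : ℝ × ℝ → ℂ) : ℝ × ℝ → ℂ := fun v =>
  (((2 * Real.pi) ^ (-(1/2 : ℝ)) : ℝ) : ℂ) *
    ∫ z : ℝ, Complex.exp (-(Complex.I * z * v.2)) * f (v.1 + (1 - p) * z, v.1 - p * z)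

-- Weyl-Wick transform on polynomials

open MvPolynomial in
/-- `∂ₓ` on complex polynomials in two variables, as an endomorphism. -/
def pdX : Module.End ℂ (MvPolynomial (Fin 2) ℂ) := (MvPolynomial.pderiv 0).toLinearMap

open MvPolynomial in
/-- `∂_ξ` on complex polynomials in two variables, as an endomorphism. -/
def pdXi : Module.End ℂ (MvPolynomial (Fin 2) ℂ) := (MvPolynomial.pderiv 1).toLinearMap

/-- The Laplacian `Δ = ∂ₓ² + ∂_ξ²` on complex polynomials in two variables. -/
def pLap : Module.End ℂ (MvPolynomial (Fin 2) ℂ) := pdX ^ 2 + pdXi ^ 2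

/-- The Weyl-Wick transform
`W[a] = Σ_{n≥0} ((-1)^n/(4^n n!)) Δ^n Σ_{l≥0} ((-i)^l/(2^l l!)) ∂ₓ^l ∂_ξ^l a`
(all sums are finite on polynomials). -/
def weylWick (a : MvPolynomial (Fin 2) ℂ) : MvPolynomial (Fin 2) ℂ :=
  ∑ n ∈ Finset.range (a.totalDegree + 1), (((-1 : ℂ) ^ n / (4 ^ n * n.factorial)) •
    (pLap ^ n) (∑ l ∈ Finset.range (a.totalDegree + 1),
      (((-Complex.I) ^ l / (2 ^ l * l.factorial)) • (pdX ^ l) ((pdXi ^ l) a))))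

/-- The inverse Weyl-Wick transform
`W⁻¹[a] = Σ_{l≥0} (i^l/(2^l l!)) ∂ₓ^l ∂_ξ^l Σ_{n≥0} (1/(4^n n!)) Δ^n a`. -/
def weylWickInv (a : MvPolynomial (Fin 2) ℂ) : MvPolynomial (Fin 2) ℂ :=
  ∑ l ∈ Finset.range (a.totalDegree + 1), ((Complex.I ^ l / (2 ^ l * l.factorial)) •
    (pdX ^ l) ((pdXi ^ l) (∑ n ∈ Finset.range (a.totalDegree + 1),
      ((1 / (4 ^ n * n.factorial) : ℂ) • (pLap ^ n) a))))

/-- Evaluation of a complex polynomial in two variables at a point of `ℝ²`. -/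
def evalP (a : MvPolynomial (Fin 2) ℂ) (v : ℝ × ℝ) : ℂ :=
  MvPolynomial.eval ![(v.1 : ℂ), (v.2 : ℂ)] a

/-- The polynomial `Σ_{j+k≤m} c_{jk} x^j ξ^k`. -/
def polyOf (m : ℕ) (c : ℕ → ℕ → ℂ) : MvPolynomial (Fin 2) ℂ :=
  ∑ jk ∈ (Finset.range (m + 1) ×ˢ Finset.range (m + 1)).filter (fun jk => jk.1 + jk.2 ≤ m),
    MvPolynomial.C (c jk.1 jk.2) * MvPolynomial.X 0 ^ jk.1 * MvPolynomial.X 1 ^ jk.2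

/-- The coherent state `Φ_{y,η}(x) = π^{-1/4} e^{ixη} e^{-(y-x)²/2}`. -/
def coherent (y η : ℝ) : ℝ → ℂ :=
  fun t => ((Real.pi ^ (-(1/4 : ℝ)) : ℝ) : ℂ) * Complex.exp (Complex.I * t * η) *
    ((Real.exp (-((y - t) ^ 2) / 2) : ℝ) : ℂ)

section PartialFourier

open scoped FourierTransform ContDiff

lemma antilipschitzWith_prodMk_right (x : ℝ) :
    AntilipschitzWith 1 (fun z : ℝ => (x, z)) :=
  (Isometry.of_dist_eq fun a b => by simp [Prod.dist_eq]).antilipschitz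

lemma hasTemperateGrowth_prodMk_right (x : ℝ) :
    Function.HasTemperateGrowth (fun z : ℝ => (x, z)) := by
  have h : (fun z : ℝ => (x, z)) =
      (fun _ : ℝ => (x, (0 : ℝ))) + (ContinuousLinearMap.inr ℝ ℝ ℝ : ℝ → ℝ × ℝ) := by
    ext z <;> simp
  rw [h]
  exact (Function.HasTemperateGrowth.const _).add (ContinuousLinearMap.hasTemperateGrowth _)

/-- The restriction of a Schwartz function on `ℝ × ℝ` to the line `{x} × ℝ`. -/
def schwartzSlice (x : ℝ) : 𝓢(ℝ × ℝ, ℂ) →L[ℂ] 𝓢(ℝ, ℂ) :=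
  compCLMOfAntilipschitz ℂ (hasTemperateGrowth_prodMk_right x) (antilipschitzWith_prodMk_right x)

@[simp]
lemma schwartzSlice_apply (x : ℝ) (f : 𝓢(ℝ × ℝ, ℂ)) (z : ℝ) : schwartzSlice x f z = f (x, z) :=
  rfl

/-- The Fourier transform in the second variable, as a function. -/
def partialFourier (f : 𝓢(ℝ × ℝ, ℂ)) (v : ℝ × ℝ) : ℂ := 𝓕 (schwartzSlice v.1 f) v.2

lemma partialFourier_eq_integral (f : 𝓢(ℝ × ℝ, ℂ)) (v : ℝ × ℝ) :
    partialFourier f v =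
      ∫ z : ℝ, Complex.exp (↑(-2 * Real.pi * z * v.2) * Complex.I) * f (v.1, z) := by
  rw [partialFourier, fourier_coe, Real.fourier_real_eq_integral_exp_smul]
  rfl

lemma partialFourier_add (f g : 𝓢(ℝ × ℝ, ℂ)) (v : ℝ × ℝ) :
    partialFourier (f + g) v = partialFourier f v + partialFourier g v := by
  simp [partialFourier, FourierTransform.fourier_add]

lemma partialFourier_smul (c : ℂ) (f : 𝓢(ℝ × ℝ, ℂ)) (v : ℝ × ℝ) :
    partialFourier (c • f) v = c * partialFourier f v := by
  simp [partialFourier, FourierTransform.fourier_smul]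

/-- Multiplication of a Schwartz function on `ℝ × ℝ` by the first coordinate. -/
def mulFst : 𝓢(ℝ × ℝ, ℂ) →L[ℂ] 𝓢(ℝ × ℝ, ℂ) :=
  smulLeftCLM ℂ (Complex.ofRealCLM.comp (ContinuousLinearMap.fst ℝ ℝ ℝ))

/-- Multiplication of a Schwartz function on `ℝ × ℝ` by the second coordinate. -/
def mulSnd : 𝓢(ℝ × ℝ, ℂ) →L[ℂ] 𝓢(ℝ × ℝ, ℂ) :=
  smulLeftCLM ℂ (Complex.ofRealCLM.comp (ContinuousLinearMap.snd ℝ ℝ ℝ))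

@[simp]
lemma mulFst_apply (f : 𝓢(ℝ × ℝ, ℂ)) (v : ℝ × ℝ) : mulFst f v = v.1 * f v := by
  rw [mulFst, smulLeftCLM_apply_apply (ContinuousLinearMap.hasTemperateGrowth _)]
  simp

@[simp]
lemma mulSnd_apply (f : 𝓢(ℝ × ℝ, ℂ)) (v : ℝ × ℝ) : mulSnd f v = v.2 * f v := by
  rw [mulSnd, smulLeftCLM_apply_apply (ContinuousLinearMap.hasTemperateGrowth _)]
  simp

/-- The derivative of a Schwartz function on `ℝ × ℝ` in a fixed direction. -/
def dirDeriv (m : ℝ × ℝ) : 𝓢(ℝ × ℝ, ℂ) →L[ℂ] 𝓢(ℝ × ℝ, ℂ) :=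
  SchwartzMap.evalCLM ℂ (ℝ × ℝ) ℂ m ∘L fderivCLM ℂ (ℝ × ℝ) ℂ

@[simp]
lemma dirDeriv_apply (m : ℝ × ℝ) (f : 𝓢(ℝ × ℝ, ℂ)) (v : ℝ × ℝ) :
    dirDeriv m f v = fderiv ℝ f v m := rfl

lemma partialFourier_mulFst (f : 𝓢(ℝ × ℝ, ℂ)) (v : ℝ × ℝ) :
    partialFourier (mulFst f) v = v.1 * partialFourier f v := by
  have h : schwartzSlice v.1 (mulFst f) = (v.1 : ℂ) • schwartzSlice v.1 f := by
    ext z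
    simp
  simp [partialFourier, h, FourierTransform.fourier_smul]

lemma partialFourier_dirDeriv_snd (f : 𝓢(ℝ × ℝ, ℂ)) (v : ℝ × ℝ) :
    partialFourier (dirDeriv (0, 1) f) v =
      2 * Real.pi * Complex.I * v.2 * partialFourier f v := by
  have h : (schwartzSlice v.1 (dirDeriv (0, 1) f) : ℝ → ℂ) = deriv (schwartzSlice v.1 f) := by
    ext z
    have h1 : HasDerivAt (fun z : ℝ => (v.1, z)) ((0 : ℝ), (1 : ℝ)) z :=
      (hasDerivAt_const z v.1).prodMk (hasDerivAt_id z)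
    exact ((f.hasFDerivAt (v.1, z)).comp_hasDerivAt z h1).deriv.symm
  rw [partialFourier, partialFourier, fourier_coe, h, Real.fourier_deriv
    (schwartzSlice v.1 f).integrable (schwartzSlice v.1 f).differentiable
    (derivCLM ℂ ℂ (schwartzSlice v.1 f)).integrable]
  simp [fourier_coe]

lemma integrable_one_add_norm_rpow_neg_two :
    Integrable (fun z : ℝ => (1 + ‖z‖) ^ (-2 : ℝ)) :=
  integrable_one_add_norm (by simp)

/-- Schwartz functions on `ℝ × ℝ` decay in the second variable, uniformly in the first. -/
lemma exists_seminorm_norm_le_one_add_norm_rpow :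
    ∃ q : Seminorm ℂ 𝓢(ℝ × ℝ, ℂ), Continuous q ∧
      ∀ f x z, ‖f (x, z)‖ ≤ q f * (1 + ‖z‖) ^ (-2 : ℝ) := by
  let q₀ : Seminorm ℂ 𝓢(ℝ × ℝ, ℂ) :=
    (Finset.Iic (2, 0)).sup (schwartzSeminormFamily ℂ (ℝ × ℝ) ℂ)
  have hq₀ : Continuous q₀ := by
    refine Seminorm.continuous_finsetSup fun i _ => ?_
    exact (schwartz_withSeminorms ℂ (ℝ × ℝ) ℂ).continuous_seminorm i
  refine ⟨(4 : NNReal) • q₀, hq₀.const_smul (4 : NNReal), fun f x z => ?_⟩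
  have h := one_add_le_sup_seminorm_apply (𝕜 := ℂ) (m := (2, 0)) le_rfl le_rfl f (x, z)
  simp only [norm_iteratedFDeriv_zero] at h
  have hz : ‖z‖ ≤ ‖(x, z)‖ := le_max_right _ _
  rw [Real.rpow_neg (by positivity), ← div_eq_mul_inv, le_div_iff₀ (by positivity), mul_comm]
  norm_cast
  refine le_trans (by gcongr) (h.trans (le_of_eq ?_))
  norm_num [q₀, schwartzSeminormFamily, NNReal.smul_def]
  rfl

lemma hasFDerivAt_partialFourier (f : 𝓢(ℝ × ℝ, ℂ)) (v : ℝ × ℝ) :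
    HasFDerivAt (partialFourier f)
      ((ContinuousLinearMap.fst ℝ ℝ ℝ).smulRight (partialFourier (dirDeriv (1, 0) f) v) +
        (ContinuousLinearMap.snd ℝ ℝ ℝ).smulRight
          (partialFourier ((-2 * Real.pi * Complex.I) • mulSnd f) v)) v := by
  obtain ⟨q, -, hq⟩ := exists_seminorm_norm_le_one_add_norm_rpow
  set g₁ := dirDeriv (1, 0) f with hg₁
  set g₂ := (-2 * Real.pi * Complex.I) • mulSnd f with hg₂
  let e : ℝ × ℝ → ℝ → ℂ := fun v z => Complex.exp (↑(-2 * Real.pi * z * v.2) * Complex.I)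
  have he : ∀ v z, ‖e v z‖ = 1 := fun v z => Complex.norm_exp_ofReal_mul_I _
  have hcont : ∀ (g : 𝓢(ℝ × ℝ, ℂ)) (w : ℝ × ℝ), Continuous fun z => e w z * g (w.1, z) := by
    intro g w
    have := g.continuous
    fun_prop
  have hint : ∀ (g : 𝓢(ℝ × ℝ, ℂ)) (w : ℝ × ℝ), Integrable fun z => e w z * g (w.1, z) := by
    intro g w
    refine (integrable_one_add_norm_rpow_neg_two.const_mul (q g)).mono'
      (hcont g w).aestronglyMeasurable (Eventually.of_forall fun z => ?_)
    rw [norm_mul, he, one_mul]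
    exact hq g w.1 z
  have hfun : partialFourier f = fun w => ∫ z, e w z * f (w.1, z) :=
    funext (partialFourier_eq_integral f)
  let L₁ : ℂ →L[ℝ] ℝ × ℝ →L[ℝ] ℂ :=
    ContinuousLinearMap.smulRightL ℝ (ℝ × ℝ) ℂ (ContinuousLinearMap.fst ℝ ℝ ℝ)
  let L₂ : ℂ →L[ℝ] ℝ × ℝ →L[ℝ] ℂ :=
    ContinuousLinearMap.smulRightL ℝ (ℝ × ℝ) ℂ (ContinuousLinearMap.snd ℝ ℝ ℝ)
  let F' : ℝ × ℝ → ℝ → ℝ × ℝ →L[ℝ] ℂ := fun w z =>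
    L₁ (e w z * g₁ (w.1, z)) + L₂ (e w z * g₂ (w.1, z))
  have hI : ∫ z, F' v z = (ContinuousLinearMap.fst ℝ ℝ ℝ).smulRight (partialFourier g₁ v) +
      (ContinuousLinearMap.snd ℝ ℝ ℝ).smulRight (partialFourier g₂ v) := by
    rw [integral_add (L₁.integrable_comp (hint g₁ v)) (L₂.integrable_comp (hint g₂ v)),
      L₁.integral_comp_comm (hint g₁ v), L₂.integral_comp_comm (hint g₂ v),
      partialFourier_eq_integral, partialFourier_eq_integral]
    rfl
  rw [hfun, ← hI]
  refine hasFDerivAt_integral_of_dominated_of_fderiv_le (F := fun w z => e w z * f (w.1, z))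
    (F' := F') (s := Set.univ)
    (bound := fun z => (‖L₁‖ * q g₁ + ‖L₂‖ * q g₂) * (1 + ‖z‖) ^ (-2 : ℝ))
    univ_mem (Eventually.of_forall fun w => (hcont f w).aestronglyMeasurable) (hint f v)
    ?_ (Eventually.of_forall fun z w _ => ?_)
    (integrable_one_add_norm_rpow_neg_two.const_mul _) (Eventually.of_forall fun z w _ => ?_)
  · exact ((L₁.continuous.comp (hcont g₁ v)).add
      (L₂.continuous.comp (hcont g₂ v))).aestronglyMeasurable
  · have hb : ∀ (L : ℂ →L[ℝ] ℝ × ℝ →L[ℝ] ℂ) (g : 𝓢(ℝ × ℝ, ℂ)),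
        ‖L (e w z * g (w.1, z))‖ ≤ ‖L‖ * (q g * (1 + ‖z‖) ^ (-2 : ℝ)) := by
      intro L g
      refine (L.le_opNorm _).trans ?_
      rw [norm_mul, he, one_mul]
      gcongr
      exact hq g w.1 z
    refine (norm_add_le _ _).trans ((add_le_add (hb L₁ g₁) (hb L₂ g₂)).trans (le_of_eq ?_))
    ring
  · have h1 : HasFDerivAt (fun w : ℝ × ℝ => ((w.1, z) : ℝ × ℝ))
        ((ContinuousLinearMap.fst ℝ ℝ ℝ).prod 0) w :=
      hasFDerivAt_fst.prodMk (hasFDerivAt_const z w)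
    have h2 := (f.hasFDerivAt (w.1, z)).comp w h1
    have h3 : HasFDerivAt (fun w : ℝ × ℝ => (↑(-2 * Real.pi * z * w.2) * Complex.I : ℂ))
        ((ContinuousLinearMap.snd ℝ ℝ ℝ).smulRight (-2 * Real.pi * z * Complex.I : ℂ)) w := by
      convert ((ContinuousLinearMap.snd ℝ ℝ ℝ).smulRight
        (-2 * Real.pi * z * Complex.I : ℂ)).hasFDerivAt (x := w) using 1
      ext w
      simp
      ring
    have h4 := h3.cexp.mul h2
    refine h4.congr_fderiv ?_
    ext
    · simp [F', L₁, L₂, hg₁, e]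
    · simp [F', L₁, L₂, hg₂, e]
      rw [Prod.mk_zero_zero, map_zero]
      ring

lemma fderiv_partialFourier (f : 𝓢(ℝ × ℝ, ℂ)) :
    fderiv ℝ (partialFourier f) =
      (ContinuousLinearMap.smulRightL ℝ (ℝ × ℝ) ℂ (ContinuousLinearMap.fst ℝ ℝ ℝ)) ∘
          partialFourier (dirDeriv (1, 0) f) +
        (ContinuousLinearMap.smulRightL ℝ (ℝ × ℝ) ℂ (ContinuousLinearMap.snd ℝ ℝ ℝ)) ∘
          partialFourier ((-2 * Real.pi * Complex.I) • mulSnd f) :=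
  funext fun v => (hasFDerivAt_partialFourier f v).fderiv

lemma contDiff_partialFourier (f : 𝓢(ℝ × ℝ, ℂ)) : ContDiff ℝ ∞ (partialFourier f) := by
  rw [contDiff_infty]
  intro n
  induction n generalizing f with
  | zero =>
    exact contDiff_zero.2 (continuous_iff_continuousAt.2 fun v =>
      (hasFDerivAt_partialFourier f v).continuousAt)
  | succ n ih =>
    push_cast
    rw [contDiff_succ_iff_fderiv]
    refine ⟨fun v => (hasFDerivAt_partialFourier f v).differentiableAt, by simp, ?_⟩
    rw [fderiv_partialFourier]
    exact (ContinuousLinearMap.contDiff _ |>.comp (ih _)).add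
      (ContinuousLinearMap.contDiff _ |>.comp (ih _))

lemma exists_seminorm_norm_partialFourier_le :
    ∃ q : Seminorm ℂ 𝓢(ℝ × ℝ, ℂ), Continuous q ∧ ∀ f v, ‖partialFourier f v‖ ≤ q f := by
  obtain ⟨q, hqc, hq⟩ := exists_seminorm_norm_le_one_add_norm_rpow
  let C : NNReal := (∫ z : ℝ, (1 + ‖z‖) ^ (-2 : ℝ)).toNNReal
  refine ⟨C • q, hqc.const_smul C, fun f v => ?_⟩
  rw [partialFourier_eq_integral]
  have h := norm_integral_le_of_norm_le (integrable_one_add_norm_rpow_neg_two.const_mul (q f))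
    (f := fun z : ℝ => Complex.exp (↑(-2 * Real.pi * z * v.2) * Complex.I) * f (v.1, z))
    (Eventually.of_forall fun z => by
      rw [norm_mul, Complex.norm_exp_ofReal_mul_I, one_mul]
      exact hq f v.1 z)
  refine h.trans (le_of_eq ?_)
  have hC : (C : ℝ) = ∫ z : ℝ, (1 + ‖z‖) ^ (-2 : ℝ) :=
    Real.coe_toNNReal _ (integral_nonneg fun z => by positivity)
  rw [integral_const_mul, ← hC, mul_comm]
  rfl

lemma norm_mul_norm_partialFourier_le (f : 𝓢(ℝ × ℝ, ℂ)) (v : ℝ × ℝ) :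
    ‖v‖ * ‖partialFourier f v‖ ≤
      ‖partialFourier (mulFst f) v‖ + ‖partialFourier (dirDeriv (0, 1) f) v‖ := by
  rw [partialFourier_mulFst, partialFourier_dirDeriv_snd]
  simp only [norm_mul, Complex.norm_real, Complex.norm_I, Complex.norm_ofNat, mul_one]
  rw [← add_mul]
  gcongr
  have hpi : 1 ≤ 2 * ‖Real.pi‖ := by
    rw [Real.norm_of_nonneg Real.pi_pos.le]
    linarith [Real.pi_gt_three]
  have h2 : ‖v.2‖ ≤ 2 * ‖Real.pi‖ * ‖v.2‖ := le_mul_of_one_le_left (norm_nonneg _) hpi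
  exact max_le (by linarith [norm_nonneg v.2]) (by linarith [norm_nonneg v.1])

lemma exists_seminorm_pow_mul_norm_partialFourier_le (k : ℕ) :
    ∃ q : Seminorm ℂ 𝓢(ℝ × ℝ, ℂ), Continuous q ∧
      ∀ f v, ‖v‖ ^ k * ‖partialFourier f v‖ ≤ q f := by
  induction k with
  | zero => simpa using exists_seminorm_norm_partialFourier_le
  | succ k ih =>
    obtain ⟨q, hqc, hq⟩ := ih
    refine ⟨q.comp mulFst.toLinearMap + q.comp (dirDeriv (0, 1)).toLinearMap,
      (hqc.comp mulFst.continuous).add (hqc.comp (dirDeriv (0, 1)).continuous), fun f v => ?_⟩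
    calc ‖v‖ ^ (k + 1) * ‖partialFourier f v‖
        = ‖v‖ ^ k * (‖v‖ * ‖partialFourier f v‖) := by ring
      _ ≤ ‖v‖ ^ k *
          (‖partialFourier (mulFst f) v‖ + ‖partialFourier (dirDeriv (0, 1) f) v‖) := by
        gcongr
        exact norm_mul_norm_partialFourier_le f v
      _ ≤ q (mulFst f) + q (dirDeriv (0, 1) f) := by
        rw [mul_add]
        exact add_le_add (hq _ _) (hq _ _)

lemma exists_seminorm_pow_mul_norm_iteratedFDeriv_partialFourier_le (k n : ℕ) :
    ∃ q : Seminorm ℂ 𝓢(ℝ × ℝ, ℂ), Continuous q ∧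
      ∀ f v, ‖v‖ ^ k * ‖iteratedFDeriv ℝ n (partialFourier f) v‖ ≤ q f := by
  induction n with
  | zero => simpa using exists_seminorm_pow_mul_norm_partialFourier_le k
  | succ n ih =>
    obtain ⟨q, hqc, hq⟩ := ih
    let L₁ : ℂ →L[ℝ] ℝ × ℝ →L[ℝ] ℂ :=
      ContinuousLinearMap.smulRightL ℝ (ℝ × ℝ) ℂ (ContinuousLinearMap.fst ℝ ℝ ℝ)
    let L₂ : ℂ →L[ℝ] ℝ × ℝ →L[ℝ] ℂ :=
      ContinuousLinearMap.smulRightL ℝ (ℝ × ℝ) ℂ (ContinuousLinearMap.snd ℝ ℝ ℝ)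
    let T : 𝓢(ℝ × ℝ, ℂ) →L[ℂ] 𝓢(ℝ × ℝ, ℂ) := (-2 * Real.pi * Complex.I : ℂ) • mulSnd
    refine ⟨‖L₁‖₊ • q.comp (dirDeriv (1, 0)).toLinearMap + ‖L₂‖₊ • q.comp T.toLinearMap,
      ((hqc.comp (dirDeriv (1, 0)).continuous).const_smul ‖L₁‖₊).add
        ((hqc.comp T.continuous).const_smul ‖L₂‖₊), fun f v => ?_⟩
    have hL : ∀ (L : ℂ →L[ℝ] ℝ × ℝ →L[ℝ] ℂ) (g : 𝓢(ℝ × ℝ, ℂ)),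
        ‖v‖ ^ k * ‖iteratedFDeriv ℝ n (L ∘ partialFourier g) v‖ ≤ ‖L‖ * q g := by
      intro L g
      have h := L.norm_iteratedFDeriv_comp_left (contDiff_partialFourier g).contDiffAt
        (x := v) (n := n) (by exact_mod_cast le_top)
      calc _ ≤ ‖v‖ ^ k * (‖L‖ * ‖iteratedFDeriv ℝ n (partialFourier g) v‖) := by gcongr
        _ = ‖L‖ * (‖v‖ ^ k * ‖iteratedFDeriv ℝ n (partialFourier g) v‖) := by ring
        _ ≤ ‖L‖ * q g := by
          gcongr
          exact hq g v
    have hs : ∀ (L : ℂ →L[ℝ] ℝ × ℝ →L[ℝ] ℂ) (g : 𝓢(ℝ × ℝ, ℂ)),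
        ContDiffAt ℝ n (L ∘ partialFourier g) v := fun L g =>
      (L.contDiff.comp ((contDiff_partialFourier g).of_le (by exact_mod_cast le_top))).contDiffAt
    rw [← norm_iteratedFDeriv_fderiv, fderiv_partialFourier, iteratedFDeriv_add_apply
      (hs _ _) (hs _ _)]
    calc _ ≤ ‖v‖ ^ k * (‖iteratedFDeriv ℝ n (L₁ ∘ partialFourier (dirDeriv (1, 0) f)) v‖ +
          ‖iteratedFDeriv ℝ n (L₂ ∘ partialFourier (T f)) v‖) := by
          gcongr
          exact norm_add_le _ _
      _ ≤ ‖L₁‖ * q (dirDeriv (1, 0) f) + ‖L₂‖ * q (T f) := by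
          rw [mul_add]
          exact add_le_add (hL _ _) (hL _ _)

/-- The Fourier transform in the second variable, on Schwartz functions. -/
def partialFourierCLM : 𝓢(ℝ × ℝ, ℂ) →L[ℂ] 𝓢(ℝ × ℝ, ℂ) :=
  SchwartzMap.mkCLM partialFourier partialFourier_add partialFourier_smul contDiff_partialFourier
    (by
      rintro ⟨k, n⟩
      obtain ⟨q, hqc, hq⟩ := exists_seminorm_pow_mul_norm_iteratedFDeriv_partialFourier_le k n
      obtain ⟨s, C, -, hC⟩ :=
        Seminorm.bound_of_continuous (schwartz_withSeminorms ℂ (ℝ × ℝ) ℂ) q hqc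
      exact ⟨s, C, C.2, fun f v => (hq f v).trans (hC f)⟩)

lemma partialFourierCLM_apply (f : 𝓢(ℝ × ℝ, ℂ)) (v : ℝ × ℝ) :
    partialFourierCLM f v = 𝓕 (schwartzSlice v.1 f) v.2 := rfl

lemma schwartzSlice_partialFourierCLM (x : ℝ) (f : 𝓢(ℝ × ℝ, ℂ)) :
    schwartzSlice x (partialFourierCLM f) = 𝓕 (schwartzSlice x f) := rfl

/-- Composition with a linear automorphism of `ℝ × ℝ`, as an automorphism of the Schwartz
space. -/
def schwartzCompCLE (g : (ℝ × ℝ) ≃L[ℝ] (ℝ × ℝ)) : 𝓢(ℝ × ℝ, ℂ) ≃L[ℂ] 𝓢(ℝ × ℝ, ℂ) :=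
  ContinuousLinearEquiv.equivOfInverse (compCLMOfContinuousLinearEquiv ℂ g)
    (compCLMOfContinuousLinearEquiv ℂ g.symm) (fun f => by ext; simp) (fun f => by ext; simp)

@[simp]
lemma schwartzCompCLE_apply (g : (ℝ × ℝ) ≃L[ℝ] (ℝ × ℝ)) (f : 𝓢(ℝ × ℝ, ℂ)) (v : ℝ × ℝ) :
    schwartzCompCLE g f v = f (g v) := rfl

/-- The reflection `(x, y) ↦ (x, -y)`. -/
def reflectSnd : (ℝ × ℝ) ≃L[ℝ] (ℝ × ℝ) :=
  (ContinuousLinearEquiv.refl ℝ ℝ).prodCongr (ContinuousLinearEquiv.neg ℝ)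

@[simp]
lemma reflectSnd_apply (v : ℝ × ℝ) : reflectSnd v = (v.1, -v.2) := rfl

lemma schwartzSlice_reflectSnd_partialFourierCLM (x : ℝ) (f : 𝓢(ℝ × ℝ, ℂ)) :
    schwartzSlice x (schwartzCompCLE reflectSnd (partialFourierCLM f)) =
      𝓕⁻ (schwartzSlice x f) := by
  ext z
  rw [fourierInv_coe, Real.fourierInv_eq_fourier_neg]
  rfl

/-- The Fourier transform in the second variable, as an automorphism of the Schwartz space. -/
def partialFourierCLE : 𝓢(ℝ × ℝ, ℂ) ≃L[ℂ] 𝓢(ℝ × ℝ, ℂ) :=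
  ContinuousLinearEquiv.equivOfInverse partialFourierCLM
    ((schwartzCompCLE reflectSnd).toContinuousLinearMap ∘L partialFourierCLM)
    (fun f => by
      ext v
      change schwartzSlice v.1 (schwartzCompCLE reflectSnd
        (partialFourierCLM (partialFourierCLM f))) v.2 = f v
      rw [schwartzSlice_reflectSnd_partialFourierCLM, schwartzSlice_partialFourierCLM,
        FourierTransform.fourierInv_fourier_eq]
      rfl)
    (fun f => by
      ext v
      change 𝓕 (schwartzSlice v.1 (schwartzCompCLE reflectSnd (partialFourierCLM f))) v.2 = f v
      rw [schwartzSlice_reflectSnd_partialFourierCLM, FourierTransform.fourier_fourierInv_eq]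
      rfl)

lemma partialFourierCLE_apply (f : 𝓢(ℝ × ℝ, ℂ)) (v : ℝ × ℝ) :
    partialFourierCLE f v =
      ∫ z : ℝ, Complex.exp (↑(-2 * Real.pi * z * v.2) * Complex.I) * f (v.1, z) :=
  partialFourier_eq_integral f v

end PartialFourier

/-- The change of variables `(x, z) ↦ (x + (1 - p) z, x - p z)`. -/
def wignerShear (p : ℝ) : (ℝ × ℝ) ≃L[ℝ] (ℝ × ℝ) :=
  LinearEquiv.toContinuousLinearEquiv
    { toFun := fun v => (v.1 + (1 - p) * v.2, v.1 - p * v.2)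
      invFun := fun v => (p * v.1 + (1 - p) * v.2, v.1 - v.2)
      map_add' := fun v w => by ext <;> simp <;> ring
      map_smul' := fun c v => by ext <;> simp <;> ring
      left_inv := fun v => by ext <;> simp <;> ring
      right_inv := fun v => by ext <;> simp <;> ring }

@[simp]
lemma wignerShear_apply (p : ℝ) (v : ℝ × ℝ) :
    wignerShear p v = (v.1 + (1 - p) * v.2, v.1 - p * v.2) := rfl

/-- The dilation `(x, y) ↦ (x, y / (2π))`. -/
def dilateSnd : (ℝ × ℝ) ≃L[ℝ] (ℝ × ℝ) :=
  (ContinuousLinearEquiv.refl ℝ ℝ).prodCongr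
    (ContinuousLinearEquiv.unitsEquivAut ℝ (Units.mk0 (2 * Real.pi)⁻¹ (by positivity)))

@[simp]
lemma dilateSnd_apply (v : ℝ × ℝ) : dilateSnd v = (v.1, v.2 * (2 * Real.pi)⁻¹) := rfl

/-- For every `p ∈ ℝ`, the Wigner-like transform maps `S(ℝ²)` into `S(ℝ²)` and
is a linear topological isomorphism of `S(ℝ²)` onto itself. -/
theorem statement19 (p : ℝ) :
    ∃ e : 𝓢(ℝ × ℝ, ℂ) ≃L[ℂ] 𝓢(ℝ × ℝ, ℂ),
      ∀ (f : 𝓢(ℝ × ℝ, ℂ)) (v : ℝ × ℝ), e f v = Wig p (⇑f) v := by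

  have hc : (((2 * Real.pi) ^ (-(1/2 : ℝ)) : ℝ) : ℂ) ≠ 0 := by
    exact_mod_cast (Real.rpow_pos_of_pos Real.two_pi_pos _).ne'
  refine ⟨(schwartzCompCLE (wignerShear p)).trans (partialFourierCLE.trans
    ((schwartzCompCLE dilateSnd).trans
      (ContinuousLinearEquiv.smulLeft (Units.mk0 _ hc)))), fun f v => ?_⟩
  change (((2 * Real.pi) ^ (-(1/2 : ℝ)) : ℝ) : ℂ) *
    partialFourierCLE (schwartzCompCLE (wignerShear p) f) (dilateSnd v) = Wig p f v
  rw [partialFourierCLE_apply, Wig]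
  congr 1
  refine integral_congr_ae (Eventually.of_forall fun z => ?_)
  simp only [schwartzCompCLE_apply, wignerShear_apply, dilateSnd_apply]
  congr 2
  have hpi : (Real.pi : ℂ) ≠ 0 := by exact_mod_cast Real.pi_ne_zero
  push_cast
  field_simp

end
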